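/- Let p ≥ 5 be a prime and let D be a nontrivial regular (v,k,λ,μ)-partial difference set in an Abelian group of order v = 8p^3 with k ≤ v/2 = 4p^3 and Δ = (λ−μ)^2 + 4(k−μ) ≤ v. Then Δ = 4p^2 or Δ = 16p^2. -/

import Mathlib

variable {G : Type*} [CommGroup G] [DecidableEq G] [Fintype G]

/-- The number of representations of `g` as `d₁ * d₂⁻¹` with `d₁, d₂ ∈ D`, `d₁ ≠ d₂`. -/
def pdsReps (D : Finset G) (g : G) : ℕ :=
  ((D ×ˢ D).filter (fun x => x.1 ≠ x.2 ∧ x.1 * x.2⁻¹ = g)).card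

/-- `D` is a `(v,k,λ,μ)`-partial difference set in `G`. -/
def IsPDS (D : Finset G) (v k l m : ℕ) : Prop :=
  Fintype.card G = v ∧ D.card = k ∧
  (∀ g : G, g ≠ 1 → g ∈ D → pdsReps D g = l) ∧
  (∀ g : G, g ≠ 1 → g ∉ D → pdsReps D g = m)

/-- `D` is regular: closed under inverses and not containing the identity. -/
def IsRegularPDS (D : Finset G) : Prop :=
  (∀ d ∈ D, d⁻¹ ∈ D) ∧ (1 : G) ∉ D

/-- A regular PDS is trivial if `D ∪ {e}` or `G \ D` is a subgroup. -/
def IsTrivialPDS (D : Finset G) : Prop :=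
  (∃ H : Subgroup G, (H : Set G) = ↑D ∪ {1}) ∨
  (∃ H : Subgroup G, (H : Set G) = (↑D : Set G)ᶜ)

lemma pdsReps_eq_card_filter {G : Type*} [CommGroup G] [DecidableEq G] (D : Finset G)
    {g : G} (hg : g ≠ 1) : pdsReps D g = (D.filter (fun a => g⁻¹ * a ∈ D)).card := by
  unfold pdsReps
  refine Finset.card_nbij' (fun x => x.1) (fun a => (a, g⁻¹ * a)) ?_ ?_ ?_ ?_
  · rintro ⟨a, b⟩ h
    simp only [Finset.coe_filter, Finset.mem_product, Set.mem_ofPred_eq] at h ⊢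
    obtain ⟨⟨ha, hb⟩, -, rfl⟩ := h
    refine ⟨ha, ?_⟩
    simpa using hb
  · intro a h
    simp only [Finset.coe_filter, Finset.mem_product, Set.mem_ofPred_eq] at h ⊢
    refine ⟨h, ?_, by simp⟩
    simpa using fun h => hg h
  · rintro ⟨a, b⟩ h
    simp only [Finset.coe_filter, Finset.mem_product, Set.mem_ofPred_eq] at h ⊢
    obtain ⟨⟨ha, hb⟩, -, rfl⟩ := h
    simp
  · intro a h
    rfl

lemma pdsReps_one {G : Type*} [CommGroup G] [DecidableEq G] (D : Finset G) : pdsReps D 1 = 0 := by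
  unfold pdsReps
  rw [Finset.card_eq_zero, Finset.filter_eq_empty_iff]
  rintro ⟨a, b⟩ - ⟨h, h'⟩
  exact h (mul_inv_eq_one.1 h')

/-- The group ring identity `D² = (k - μ) + (λ - μ) D + μ G`, evaluated by a function on `G`. -/
lemma IsPDS.sum_sum_mul {D : Finset G} {v k l m : ℕ} (hD : IsPDS D v k l m)
    (hreg : IsRegularPDS D) {A : Type*} [CommRing A] (f : G → A) :
    ∑ a ∈ D, ∑ b ∈ D, f (a * b) =
      ((k : A) - m) * f 1 + ((l : A) - m) * ∑ a ∈ D, f a + (m : A) * ∑ g, f g := by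
  have hinv : ∀ a ∈ D, ∑ b ∈ D, f (a * b) = ∑ b ∈ D, f (a * b⁻¹) := fun a _ =>
    Finset.sum_nbij' (·⁻¹) (·⁻¹) hreg.1 hreg.1 (by simp) (by simp) (by simp)
  rw [Finset.sum_congr rfl hinv,
    ← Finset.sum_product (s := D) (t := D) (f := fun x => f (x.1 * x.2⁻¹)),
    ← Finset.sum_filter_add_sum_filter_not (D ×ˢ D) (fun x => x.1 ≠ x.2)]
  have hdiag : ∑ x ∈ (D ×ˢ D).filter (fun x => ¬ x.1 ≠ x.2), f (x.1 * x.2⁻¹) = k * f 1 := by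
    rw [← hD.2.1, ← nsmul_eq_mul, ← Finset.sum_const]
    refine Finset.sum_nbij' (fun x => x.1) (fun a => (a, a)) ?_ ?_ ?_ ?_ ?_ <;> aesop
  have hoff : ∑ x ∈ (D ×ˢ D).filter (fun x => x.1 ≠ x.2), f (x.1 * x.2⁻¹) =
      ∑ g, (pdsReps D g : A) * f g := by
    rw [← Finset.sum_fiberwise _ (fun x : G × G => x.1 * x.2⁻¹)]
    refine Finset.sum_congr rfl fun g _ => ?_
    rw [pdsReps, Finset.filter_filter, ← nsmul_eq_mul, ← Finset.sum_const]
    refine Finset.sum_congr rfl fun x hx => ?_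
    rw [(Finset.mem_filter.1 hx).2.2]
  have hreps : ∀ g, (pdsReps D g : A) * f g =
      m * f g + (if g ∈ D then ((l : A) - m) * f g else 0) - (if g = 1 then m * f g else 0) := by
    intro g
    by_cases h1 : g = 1
    · subst h1
      simp [pdsReps_one, hreg.2]
    · by_cases hg : g ∈ D
      · simp [hD.2.2.1 g h1 hg, h1, hg]
        ring
      · simp [hD.2.2.2 g h1 hg, h1, hg]
  rw [hdiag, hoff, Finset.sum_congr rfl fun g _ => hreps g, Finset.sum_sub_distrib,
    Finset.sum_add_distrib, Finset.sum_ite_mem, Finset.sum_ite_eq', ← Finset.mul_sum,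
    ← Finset.mul_sum]
  simp
  ring

/-- A regular partial difference set contained in a proper subgroup is trivial. -/
lemma IsPDS.isTrivial_of_subset_subgroup {D : Finset G} {v k l m : ℕ} (hD : IsPDS D v k l m)
    (hreg : IsRegularPDS D) {H : Subgroup G} (hH : H ≠ ⊤) (hDH : ∀ d ∈ D, d ∈ H) :
    IsTrivialPDS D := by
  obtain ⟨g, hg⟩ : ∃ g, g ∉ H := by
    by_contra! h
    exact hH (Subgroup.eq_top_iff' H |>.2 h)
  have hg1 : g ≠ 1 := fun h => hg (h ▸ H.one_mem)
  have hm : m = 0 := by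
    rw [← hD.2.2.2 g hg1 fun h => hg (hDH g h), pdsReps_eq_card_filter D hg1,
      Finset.card_eq_zero, Finset.filter_eq_empty_iff]
    intro a ha hga
    apply hg
    simpa using H.mul_mem (hDH a ha) (H.inv_mem (hDH _ hga))
  have hmul : ∀ a ∈ D, ∀ b ∈ D, a * b = 1 ∨ a * b ∈ D := by
    intro a ha b hb
    by_contra! h
    have h0 := hD.2.2.2 _ h.1 h.2
    rw [hm, pdsReps_eq_card_filter D h.1, Finset.card_eq_zero, Finset.filter_eq_empty_iff] at h0
    exact h0 ha (by simpa using hreg.1 b hb)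
  refine Or.inl ⟨⟨⟨⟨↑D ∪ {1}, ?_⟩, by simp⟩, ?_⟩, rfl⟩
  · rintro a b (ha | rfl) (hb | rfl)
    · exact (hmul a ha b hb).symm
    · left; simpa using ha
    · left; simpa using hb
    · right; simp
  · rintro a (ha | rfl)
    · exact Or.inl (hreg.1 a ha)
    · right; simp

lemma IsPDS.isTrivial_of_mu_eq {D : Finset G} {v k l m : ℕ} (hD : IsPDS D v k l m)
    (hreg : IsRegularPDS D) (hm : m = k) : IsTrivialPDS D := by
  have key : ∀ g, g ∉ D → ∀ a ∈ D, g⁻¹ * a ∈ D := by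
    intro g hg
    by_cases h1 : g = 1
    · simp [h1]
    · have h := hD.2.2.2 g h1 hg
      rw [pdsReps_eq_card_filter D h1, hm, ← hD.2.1] at h
      exact Finset.card_filter_eq_iff.1 h
  refine Or.inr ⟨⟨⟨⟨(↑D)ᶜ, ?_⟩, by simpa using hreg.2⟩, ?_⟩, rfl⟩
  · intro a b ha hb hab
    exact hb (by simpa using key a ha _ hab)
  · intro a ha h
    exact ha (by simpa using hreg.1 _ h)

lemma IsPDS.isTrivial_of_lambda_eq {D : Finset G} {v k l m : ℕ} (hD : IsPDS D v k l m)
    (hreg : IsRegularPDS D) (hl : l = k - 1) : IsTrivialPDS D := by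
  have key : ∀ g ∈ D, ∀ a ∈ D, a ≠ g → g⁻¹ * a ∈ D := by
    intro g hg a ha hag
    have h1 : g ≠ 1 := fun h => hreg.2 (h ▸ hg)
    have h := hD.2.2.1 g h1 hg
    rw [pdsReps_eq_card_filter D h1, hl, ← hD.2.1, ← Finset.card_erase_of_mem hg] at h
    have hsub : D.filter (fun a => g⁻¹ * a ∈ D) ⊆ D.erase g := by
      intro b hb
      rw [Finset.mem_filter] at hb
      refine Finset.mem_erase.2 ⟨?_, hb.1⟩
      rintro rfl
      exact hreg.2 (by simpa using hb.2)
    have := Finset.eq_of_subset_of_card_le hsub h.ge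
    have hmem : a ∈ D.erase g := Finset.mem_erase.2 ⟨hag, ha⟩
    rw [← this] at hmem
    exact (Finset.mem_filter.1 hmem).2
  refine Or.inl ⟨⟨⟨⟨↑D ∪ {1}, ?_⟩, by simp⟩, ?_⟩, rfl⟩
  · rintro a b (ha | rfl) (hb | rfl)
    · by_cases h : b = a⁻¹
      · right; simp [h]
      · left; simpa using key _ (hreg.1 a ha) b hb h
    · left; simpa using ha
    · left; simpa using hb
    · right; simp
  · rintro a (ha | rfl)
    · exact Or.inl (hreg.1 a ha)
    · right; simp

/-- A regular partial difference set that is invariant, away from `1` and `t`, under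
multiplication by an involution `t` is trivial. -/
lemma IsPDS.isTrivial_of_involution {D : Finset G} {v k l m : ℕ} (hD : IsPDS D v k l m)
    (hreg : IsRegularPDS D) {t : G} (ht1 : t ≠ 1) (ht : t * t = 1)
    (hinv : ∀ h, h ≠ 1 → h ≠ t → h ∈ D → t * h ∈ D) : IsTrivialPDS D := by
  have htinv : t⁻¹ = t := inv_eq_of_mul_eq_one_left ht
  by_cases htD : t ∈ D
  · refine hD.isTrivial_of_lambda_eq hreg ?_
    rw [← hD.2.2.1 t ht1 htD, pdsReps_eq_card_filter D ht1, ← hD.2.1,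
      ← Finset.card_erase_of_mem htD, htinv]
    congr 1
    ext a
    simp only [Finset.mem_filter, Finset.mem_erase]
    constructor
    · rintro ⟨ha, hta⟩
      refine ⟨?_, ha⟩
      rintro rfl
      exact hreg.2 (ht ▸ hta)
    · rintro ⟨hat, ha⟩
      exact ⟨ha, hinv a (fun h => hreg.2 (h ▸ ha)) hat ha⟩
  · refine hD.isTrivial_of_mu_eq hreg ?_
    rw [← hD.2.2.2 t ht1 htD, pdsReps_eq_card_filter D ht1, ← hD.2.1, htinv]
    congr 1
    rw [Finset.filter_eq_self]
    exact fun a ha => hinv a (fun h => hreg.2 (h ▸ ha)) (fun h => htD (h ▸ ha)) ha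

lemma MonoidAlgebra.exists_mul_sum_single {K G : Type*} [CommRing K] [CommGroup G] [Fintype G]
    (y : MonoidAlgebra K G) :
    ∃ c : K, y * ∑ g : G, MonoidAlgebra.single g (1 : K) =
      c • ∑ g : G, MonoidAlgebra.single g (1 : K) := by
  induction y using MonoidAlgebra.induction_on with
  | of a =>
    refine ⟨1, ?_⟩
    rw [Finset.mul_sum, one_smul, MonoidAlgebra.of_apply]
    simp only [MonoidAlgebra.single_mul_single, one_mul]
    exact Equiv.sum_comp (Equiv.mulLeft a) fun g => MonoidAlgebra.single g (1 : K)
  | add y z hy hz =>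
    obtain ⟨c, hc⟩ := hy
    obtain ⟨d, hd⟩ := hz
    exact ⟨c + d, by rw [add_mul, hc, hd, add_smul]⟩
  | smul r y hy =>
    obtain ⟨c, hc⟩ := hy
    exact ⟨r * c, by rw [smul_mul_assoc, hc, mul_smul]⟩

lemma powMonoidHom_range_ne_top {G : Type*} [CommGroup G] [Fintype G] {q : ℕ} (hq : q.Prime)
    (hqG : q ∣ Fintype.card G) :
    (powMonoidHom q : G →* G).range ≠ ⊤ := by
  have := Fact.mk hq
  obtain ⟨g, hg⟩ := exists_prime_orderOf_dvd_card q hqG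
  intro htop
  have hinj := Finite.injective_iff_surjective.2 (MonoidHom.range_eq_top.1 htop)
  have h1 : g = 1 := hinj (by simp [← hg, pow_orderOf_eq_one])
  rw [h1, orderOf_one] at hg
  exact hq.ne_one hg.symm

/-- If `q` does not divide a square root of `Δ`, then modulo `q` the group ring element `D` agrees
with its `q`-th power up to a constant. -/
lemma IsPDS.exists_mem_iff_of_notMem_range {D : Finset G} {v k l m : ℕ} (hD : IsPDS D v k l m)
    (hreg : IsRegularPDS D) {q : ℕ} (hq : q.Prime) {δ : ℤ}
    (hδ : δ ^ 2 = ((l : ℤ) - m) ^ 2 + 4 * ((k : ℤ) - m)) (hqδ : ¬ (q : ℤ) ∣ δ) :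
    ∃ c : ZMod q, ∀ g : G, g ∉ (powMonoidHom q : G →* G).range →
      (if g ∈ D then (1 : ZMod q) else 0) = c := by
  have := Fact.mk hq
  obtain ⟨r, s, hrs, hrδ⟩ : ∃ r s : ℤ, r + s = (l : ℤ) - m ∧ r - s = δ := by
    have h2 : Even (δ + ((l : ℤ) - m)) := by
      have : Even (δ ^ 2 + ((l : ℤ) - m) ^ 2) := by
        rw [hδ]
        exact ⟨((l : ℤ) - m) ^ 2 + 2 * ((k : ℤ) - m), by ring⟩
      rw [Int.even_add, Int.even_pow' two_ne_zero, Int.even_pow' two_ne_zero] at this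
      rwa [Int.even_add]
    obtain ⟨r, hr⟩ := h2
    exact ⟨r, r - δ, by linarith, by ring⟩
  have hprod : r * s = -((k : ℤ) - m) := by
    rw [← hrs, ← hrδ] at hδ
    linarith
  let x : MonoidAlgebra (ZMod q) G := ∑ a ∈ D, MonoidAlgebra.single a 1
  let J : MonoidAlgebra (ZMod q) G := ∑ g, MonoidAlgebra.single g 1
  have hxx : x * x = ((k : MonoidAlgebra (ZMod q) G) - m) + (l - m) * x + m * J := by
    have h := hD.sum_sum_mul hreg fun g => MonoidAlgebra.single g (1 : ZMod q)
    rw [← MonoidAlgebra.one_def, mul_one] at h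
    rw [← h, Finset.sum_mul_sum]
    simp [MonoidAlgebra.single_mul_single]
  have hfac : (x - (r : MonoidAlgebra (ZMod q) G)) * (x - (s : MonoidAlgebra (ZMod q) G)) =
      m * J := by
    have h1 := congrArg (Int.cast : ℤ → MonoidAlgebra (ZMod q) G) hrs
    have h2 := congrArg (Int.cast : ℤ → MonoidAlgebra (ZMod q) G) hprod
    push_cast at h1 h2
    linear_combination hxx - x * h1 + h2
  have hdvd : (Polynomial.X - Polynomial.C (r : ZMod q)) * (Polynomial.X - Polynomial.C (s : ZMod q))
      ∣ Polynomial.X ^ q - Polynomial.X := by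
    refine IsCoprime.mul_dvd (Polynomial.isCoprime_X_sub_C_of_isUnit_sub ?_) ?_ ?_
    · rw [isUnit_iff_ne_zero, ← Int.cast_sub, hrδ]
      rwa [Ne, ZMod.intCast_zmod_eq_zero_iff_dvd]
    · rw [Polynomial.dvd_iff_isRoot]; simp
    · rw [Polynomial.dvd_iff_isRoot]; simp
  obtain ⟨P, hP⟩ := hdvd
  have hPx := congrArg (Polynomial.aeval x) hP
  simp only [map_sub, map_mul, map_pow, Polynomial.aeval_X, map_intCast] at hPx
  rw [hfac] at hPx
  obtain ⟨c, hc⟩ := MonoidAlgebra.exists_mul_sum_single ((m : MonoidAlgebra (ZMod q) G) *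
    Polynomial.aeval x P)
  have hxq : x ^ q = ∑ a ∈ D, MonoidAlgebra.single (a ^ q) 1 := by
    have : CharP (MonoidAlgebra (ZMod q) G) q :=
      charP_of_injective_algebraMap (algebraMap (ZMod q) (MonoidAlgebra (ZMod q) G)).injective q
    rw [sum_pow_char]
    simp [MonoidAlgebra.single_pow]
  have key : ∑ a ∈ D, MonoidAlgebra.single (a ^ q) (1 : ZMod q) = x + c • J := by
    rw [← hxq, ← hc]
    linear_combination hPx
  refine ⟨-c, fun g hg => ?_⟩
  have hg' := congrArg (fun y : MonoidAlgebra (ZMod q) G => y.coeff g) key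
  have hzero : ∀ a ∈ D, ¬ a ^ q = g := fun a _ h => hg ⟨a, h⟩
  simp [x, J, Finsupp.finsetSum_apply, Finsupp.single_apply] at hg'
  rw [Finset.filter_false_of_mem hzero, Finset.card_empty, Nat.cast_zero] at hg'
  linear_combination -hg'

/-- Every prime divisor of the group order divides a square root of `Δ`. -/
lemma IsPDS.prime_dvd {D : Finset G} {v k l m : ℕ} (hD : IsPDS D v k l m)
    (hreg : IsRegularPDS D) (hnt : ¬ IsTrivialPDS D) (hkv : 2 * k ≤ v) {q : ℕ} (hq : q.Prime)
    (hqv : q ∣ v) {δ : ℤ} (hδ : δ ^ 2 = ((l : ℤ) - m) ^ 2 + 4 * ((k : ℤ) - m)) :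
    (q : ℤ) ∣ δ := by
  by_contra hqδ
  have := Fact.mk hq
  obtain ⟨c, hc⟩ := hD.exists_mem_iff_of_notMem_range hreg hq hδ hqδ
  have htop := powMonoidHom_range_ne_top (G := G) hq (hD.1 ▸ hqv)
  set H := (powMonoidHom q : G →* G).range
  by_cases h : ∀ d ∈ D, d ∈ H
  · exact hnt (hD.isTrivial_of_subset_subgroup hreg htop h)
  · push Not at h
    obtain ⟨d, hdD, hdH⟩ := h
    have hcompl : ∀ g ∉ H, g ∈ D := by
      intro g hg
      by_contra hgD
      have h1 := hc d hdH
      rw [← hc g hg, if_pos hdD, if_neg hgD] at h1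
      exact one_ne_zero h1
    classical
    have hcard : 2 * Nat.card H ≤ v := by
      have hmul := H.card_mul_index
      have hidx : 2 ≤ H.index := by
        have h0 := H.index_ne_zero_of_finite
        have h1 : H.index ≠ 1 := fun h => htop (Subgroup.index_eq_one.1 h)
        omega
      rw [Nat.card_eq_fintype_card (α := G), hD.1] at hmul
      nlinarith
    let S : Finset G := Finset.univ.filter (· ∈ H)
    have hS : S.card = Nat.card H := by
      rw [Nat.card_eq_fintype_card, Fintype.card_subtype]
    have hsub : Sᶜ ⊆ D := by
      intro g hg
      exact hcompl g (by simpa [S] using hg)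
    have hSD : Sᶜ = D := by
      refine Finset.eq_of_subset_of_card_le hsub ?_
      rw [Finset.card_compl, hS, hD.1, hD.2.1]
      omega
    refine hnt (Or.inr ⟨H, ?_⟩)
    rw [← hSD]
    ext g
    simp [S]

/-- The value of the character `χ` at `∑ d ∈ D, d`. -/
noncomputable def charSum {G : Type*} [CommGroup G] (D : Finset G) (χ : AddChar (Additive G) ℂ) : ℂ :=
  ∑ a ∈ D, χ (Additive.ofMul a)

lemma IsPDS.charSum_sq {D : Finset G} {v k l m : ℕ} (hD : IsPDS D v k l m)
    (hreg : IsRegularPDS D) {χ : AddChar (Additive G) ℂ} (hχ : χ ≠ 0) :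
    charSum D χ ^ 2 = ((l : ℂ) - m) * charSum D χ + ((k : ℂ) - m) := by
  have h := hD.sum_sum_mul hreg fun g => χ (Additive.ofMul g)
  have h0 : ∑ g : G, χ (Additive.ofMul g) = 0 :=
    (Equiv.sum_comp Additive.ofMul χ).trans (AddChar.sum_eq_zero_iff_ne_zero.2 hχ)
  simp only [ofMul_mul, AddChar.map_add_eq_mul, ofMul_one, AddChar.map_zero_eq_one, h0] at h
  rw [sq, charSum, Finset.sum_mul_sum, h]
  ring

lemma sum_addChar_ofMul (g : G) :
    ∑ χ : AddChar (Additive G) ℂ, χ (Additive.ofMul g) =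
      if g = 1 then (Fintype.card G : ℂ) else 0 := by
  rw [AddChar.sum_apply_eq_ite, Fintype.card_congr Additive.toMul]
  simp only [ofMul_eq_zero]

lemma sum_charSum_mul (D : Finset G) (g : G) :
    ∑ χ, charSum D χ * χ (Additive.ofMul g⁻¹) = if g ∈ D then (Fintype.card G : ℂ) else 0 := by
  simp only [charSum, Finset.sum_mul, ← AddChar.map_add_eq_mul, ← ofMul_mul]
  rw [Finset.sum_comm]
  simp only [sum_addChar_ofMul, mul_inv_eq_one, Finset.sum_ite_eq']

lemma charSum_zero {G : Type*} [CommGroup G] (D : Finset G) : charSum D 0 = D.card := by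
  simp [charSum]

lemma isIntegral_addChar_ofMul {G : Type*} [CommGroup G] [Fintype G]
    (χ : AddChar (Additive G) ℂ) (g : G) :
    IsIntegral ℤ (χ (Additive.ofMul g)) := by
  refine IsIntegral.of_pow (n := Fintype.card G) Fintype.card_pos ?_
  rw [← AddChar.map_nsmul_eq_pow, ← ofMul_pow, pow_card_eq_one, ofMul_one,
    AddChar.map_zero_eq_one]
  exact isIntegral_one

lemma Int.dvd_of_isIntegral_of_mul_eq {z : ℂ} (hz : IsIntegral ℤ z) {a b : ℤ} (ha : a ≠ 0)
    (h : (a : ℂ) * z = b) : a ∣ b := by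
  have ha' : (a : ℂ) ≠ 0 := Int.cast_ne_zero.2 ha
  have hzq : z = algebraMap ℚ ℂ ((b : ℚ) / a) := by
    rw [map_div₀, map_intCast, map_intCast, eq_div_iff ha', ← h, mul_comm]
  rw [hzq, isIntegral_algebraMap_iff (algebraMap ℚ ℂ).injective,
    IsIntegrallyClosed.isIntegral_iff] at hz
  obtain ⟨n, hn⟩ := hz
  refine ⟨n, ?_⟩
  rw [eq_div_iff (Int.cast_ne_zero.2 ha), eq_intCast] at hn
  rw [mul_comm]
  exact_mod_cast hn.symm

/-- If all `f i` equal `w` or `-w`, their sum is an integer multiple of `w`. -/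
lemma Finset.exists_sum_eq_intCast_mul {ι : Type*} (s : Finset ι) (f : ι → ℂ) (w : ℂ)
    (h : ∀ i ∈ s, f i = w ∨ f i = -w) : ∃ N : ℤ, ∑ i ∈ s, f i = N * w := by
  have h' : ∀ i ∈ s, ∃ n : ℤ, f i = n * w := by
    intro i hi
    rcases h i hi with h | h
    · exact ⟨1, by simp [h]⟩
    · exact ⟨-1, by simp [h]⟩
  choose! n hn using h'
  exact ⟨∑ i ∈ s, n i, by rw [Finset.sum_congr rfl hn, Int.cast_sum, Finset.sum_mul]⟩

lemma IsPDS.exists_sq_eq_delta {D : Finset G} {v k l m : ℕ} (hD : IsPDS D v k l m)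
    (hreg : IsRegularPDS D) (hk : 0 < k) (hkv : 2 * k ≤ v) (hv : Even v)
    (hv2 : 2 < v) :
    ∃ δ : ℤ, 0 < δ ∧ δ ^ 2 = ((l : ℤ) - m) ^ 2 + 4 * ((k : ℤ) - m) := by
  classical
  set β : ℤ := (l : ℤ) - m with hβ
  set Δ : ℤ := β ^ 2 + 4 * ((k : ℤ) - m) with hΔ
  obtain ⟨w, hw⟩ := IsAlgClosed.exists_pow_nat_eq (Δ : ℂ) two_pos
  have hβC : (β : ℂ) = (l : ℂ) - m := by simp [hβ]
  have hval : ∀ χ ∈ Finset.univ.erase (0 : AddChar (Additive G) ℂ),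
      2 * charSum D χ - β = w ∨ 2 * charSum D χ - β = -w := by
    intro χ hχ
    have h := hD.charSum_sq hreg (Finset.ne_of_mem_erase hχ)
    rw [← sq_eq_sq_iff_eq_or_eq_neg, hw, hΔ]
    push_cast
    rw [← hβC] at h
    linear_combination 4 * h
  obtain ⟨N, hN⟩ := Finset.exists_sum_eq_intCast_mul _ _ w hval
  have hsum : ∑ χ ∈ Finset.univ.erase (0 : AddChar (Additive G) ℂ), (2 * charSum D χ - β) =
      -(2 * k + (v - 1) * β) := by
    have h1 := sum_charSum_mul D 1
    simp only [inv_one, ofMul_one, AddChar.map_zero_eq_one, mul_one, if_neg hreg.2] at h1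
    have hcard : (Finset.univ : Finset (AddChar (Additive G) ℂ)).card = v := by
      rw [Finset.card_univ, AddChar.card_eq, ← hD.1, Fintype.card_congr Additive.toMul]
    rw [Finset.sum_erase_eq_sub (Finset.mem_univ _), Finset.sum_sub_distrib, ← Finset.mul_sum, h1,
      charSum_zero, hD.2.1, Finset.sum_const, hcard, nsmul_eq_mul]
    ring
  set M : ℤ := -(2 * k + ((v : ℤ) - 1) * β) with hM
  have hMN : (M : ℂ) = N * w := by
    rw [← hN, hsum, hM]
    push_cast
    ring
  have hM0 : M ≠ 0 := by
    intro h
    have hkv' : (2 : ℤ) * k ≤ v := by exact_mod_cast hkv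
    have hv2' : (2 : ℤ) < v := by exact_mod_cast hv2
    have hk' : (0 : ℤ) < k := by exact_mod_cast hk
    have hβ0 : β < 0 := by
      by_contra! h0
      nlinarith
    have hβ1 : -2 < β := by
      by_contra! h0
      nlinarith
    have hβ2 : β = -1 := by omega
    rw [hβ2] at hM
    obtain ⟨u, hu⟩ := hv
    omega
  have hsq : M ^ 2 = N ^ 2 * Δ := by
    have : (M : ℂ) ^ 2 = N ^ 2 * Δ := by rw [hMN, mul_pow, hw]
    exact_mod_cast this
  obtain ⟨δ, hδ⟩ := (Int.pow_dvd_pow_iff two_ne_zero).1 ⟨Δ, hsq⟩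
  have hN0 : N ≠ 0 := fun h => hM0 (by simp [hδ, h])
  have hδ0 : δ ≠ 0 := fun h => hM0 (by simp [hδ, h])
  refine ⟨|δ|, abs_pos.2 hδ0, ?_⟩
  rw [sq_abs]
  rw [hδ, mul_pow] at hsq
  exact mul_left_cancel₀ (pow_ne_zero 2 hN0) hsq

/-- The indicator function of `D` away from the identity, expressed through the characters that
take the larger eigenvalue at `D`. -/
lemma IsPDS.exists_dual {D : Finset G} {v k l m : ℕ} (hD : IsPDS D v k l m)
    (hreg : IsRegularPDS D) {δ : ℤ}
    (hδ : δ ^ 2 = ((l : ℤ) - m) ^ 2 + 4 * ((k : ℤ) - m)) :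
    ∃ (E : Finset (AddChar (Additive G) ℂ)) (c : ℂ), ∀ g : G, g ≠ 1 →
      (δ : ℂ) * ∑ χ ∈ E, χ (Additive.ofMul g⁻¹) + c = if g ∈ D then (v : ℂ) else 0 := by
  classical
  have hδC : (δ : ℂ) ^ 2 = ((l : ℂ) - m) ^ 2 + 4 * ((k : ℂ) - m) := by exact_mod_cast hδ
  set s : ℂ := ((l : ℂ) - m - δ) / 2 with hs
  set E := (Finset.univ.erase (0 : AddChar (Additive G) ℂ)).filter fun χ => charSum D χ ≠ s
    with hE
  have hval : ∀ χ : AddChar (Additive G) ℂ, charSum D χ =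
      s + (if χ ∈ E then (δ : ℂ) else 0) + (if χ = 0 then k - s else 0) := by
    intro χ
    by_cases h0 : χ = 0
    · simp [h0, hE, charSum_zero, hD.2.1]
    · by_cases h1 : charSum D χ = s
      · simp [h0, hE, h1]
      · have h := hD.charSum_sq hreg h0
        have h2 : (charSum D χ - s) * (charSum D χ - (s + δ)) = 0 := by
          rw [hs]
          linear_combination h - hδC / 4
        have h3 := (mul_eq_zero.1 h2).resolve_left (sub_ne_zero.2 h1)
        simp [h0, hE, h1]
        linear_combination h3
  refine ⟨E, k - s, fun g hg => ?_⟩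
  have h := sum_charSum_mul D g
  rw [Finset.sum_congr rfl fun χ _ => congrArg (· * χ (Additive.ofMul g⁻¹)) (hval χ), hD.1] at h
  rw [← h]
  simp only [add_mul, Finset.sum_add_distrib, ite_mul, zero_mul, Finset.sum_ite_mem,
    Finset.univ_inter, Finset.sum_ite_eq', Finset.mem_univ, if_true, ← Finset.mul_sum,
    sum_addChar_ofMul, inv_eq_one, hg, if_false, AddChar.zero_apply]
  ring

/-- Twice a square root of `Δ` divides the (even) order of the group. -/
lemma IsPDS.two_mul_delta_dvd {D : Finset G} {v k l m : ℕ} (hD : IsPDS D v k l m)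
    (hreg : IsRegularPDS D) (hnt : ¬ IsTrivialPDS D) (hv : Even v) {δ : ℤ} (hδ0 : δ ≠ 0)
    (hδ : δ ^ 2 = ((l : ℤ) - m) ^ 2 + 4 * ((k : ℤ) - m)) : 2 * δ ∣ v := by
  have := Fact.mk Nat.prime_two
  obtain ⟨t, ht⟩ := exists_prime_orderOf_dvd_card 2 (hD.1 ▸ hv.two_dvd : 2 ∣ Fintype.card G)
  have ht1 : t ≠ 1 := fun h => by simp [h] at ht
  have htt : t * t = 1 := by rw [← sq, ← ht, pow_orderOf_eq_one]
  have htinv : t⁻¹ = t := inv_eq_of_mul_eq_one_left htt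
  obtain ⟨h, h1, h2, hhD, hth⟩ : ∃ h, h ≠ 1 ∧ h ≠ t ∧ h ∈ D ∧ t * h ∉ D := by
    by_contra! hcon
    exact hnt (hD.isTrivial_of_involution hreg ht1 htt hcon)
  obtain ⟨E, c, hE⟩ := hD.exists_dual hreg hδ
  have e1 := hE h h1
  have e2 := hE (t * h) fun hh => h2 (by rw [← htinv]; exact eq_inv_of_mul_eq_one_right hh)
  rw [if_pos hhD] at e1
  rw [if_neg hth] at e2
  have hpair : ∀ χ : AddChar (Additive G) ℂ, ∃ z : ℂ, IsIntegral ℤ z ∧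
      χ (Additive.ofMul h⁻¹) - χ (Additive.ofMul (t * h)⁻¹) = 2 * z := by
    intro χ
    have hχ : χ (Additive.ofMul t) ^ 2 = 1 := by
      rw [sq, ← AddChar.map_add_eq_mul, ← ofMul_mul, htt, ofMul_one, AddChar.map_zero_eq_one]
    rw [mul_inv, htinv, ofMul_mul, AddChar.map_add_eq_mul]
    rcases (sq_eq_sq_iff_eq_or_eq_neg.1 (hχ.trans (one_pow 2).symm)) with h' | h'
    · exact ⟨0, isIntegral_zero, by simp [h']⟩
    · exact ⟨_, isIntegral_addChar_ofMul χ h⁻¹, by rw [h']; ring⟩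
  choose z hz hz' using hpair
  refine Int.dvd_of_isIntegral_of_mul_eq (IsIntegral.sum (s := E) _ fun χ _ => hz χ)
    (mul_ne_zero two_ne_zero hδ0) ?_
  have hsum : ∑ χ ∈ E, χ (Additive.ofMul h⁻¹) - ∑ χ ∈ E, χ (Additive.ofMul (t * h)⁻¹) =
      2 * ∑ χ ∈ E, z χ := by
    rw [← Finset.sum_sub_distrib, Finset.mul_sum]
    exact Finset.sum_congr rfl fun χ _ => hz' χ
  push_cast
  linear_combination e1 - e2 - δ * hsum

/-- For a nontrivial regular PDS in an Abelian group of order `8p^3` with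
`k ≤ 4p^3` and `Δ ≤ 8p^3`, `p ≥ 5` prime, we have `Δ = 4p^2` or `Δ = 16p^2`. -/
theorem pds_delta_values (p : ℕ) (hp : p.Prime) (hp5 : 5 ≤ p)
    {G : Type*} [CommGroup G] [DecidableEq G] [Fintype G]
    (D : Finset G) (k l m : ℕ)
    (hPDS : IsPDS D (8 * p ^ 3) k l m) (hreg : IsRegularPDS D)
    (hnt : ¬ IsTrivialPDS D) (hk : k ≤ 4 * p ^ 3)
    (hΔ : ((l : ℤ) - m) ^ 2 + 4 * ((k : ℤ) - m) ≤ 8 * p ^ 3) :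
    ((l : ℤ) - m) ^ 2 + 4 * ((k : ℤ) - m) = 4 * p ^ 2 ∨
      ((l : ℤ) - m) ^ 2 + 4 * ((k : ℤ) - m) = 16 * p ^ 2 := by
  have hppos : 0 < p ^ 3 := pow_pos hp.pos 3
  have hkpos : 0 < k := by
    rw [← hPDS.2.1, Finset.card_pos, Finset.nonempty_iff_ne_empty]
    rintro rfl
    exact hnt (Or.inl ⟨⊥, by simp⟩)
  have heven : Even (8 * p ^ 3) := ⟨4 * p ^ 3, by ring⟩
  obtain ⟨δ, hδpos, hδ⟩ :=
    hPDS.exists_sq_eq_delta hreg hkpos (by omega) heven (by omega)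
  have h2 := hPDS.prime_dvd hreg hnt (by omega) Nat.prime_two heven.two_dvd hδ
  have hp' := hPDS.prime_dvd hreg hnt (by omega) hp
    (Dvd.dvd.mul_left (dvd_pow_self p three_ne_zero) 8) hδ
  have hdvd := hPDS.two_mul_delta_dvd hreg hnt heven hδpos.ne' hδ
  rw [← hδ] at hΔ ⊢
  lift δ to ℕ using hδpos.le
  norm_cast at h2 hp' hdvd hΔ hδpos ⊢
  have hcop : Nat.Coprime 2 p := (Nat.coprime_primes Nat.prime_two hp).2 (by omega)
  obtain ⟨e, rfl⟩ := hcop.mul_dvd_of_dvd_of_dvd h2 hp'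
  have hepos : 0 < e := Nat.pos_of_mul_pos_left hδpos
  have he : e ∣ 2 * p ^ 2 := by
    rw [show 2 * (2 * p * e) = 4 * p * e by ring,
      show 8 * p ^ 3 = 4 * p * (2 * p ^ 2) by ring] at hdvd
    exact Nat.dvd_of_mul_dvd_mul_left (by have := hp.pos; omega) hdvd
  have hlt : e < p := by
    by_contra! hle
    have h1 : p ^ 2 ≤ e ^ 2 := Nat.pow_le_pow_left hle 2
    have h3 : 4 * p ^ 2 * p ^ 2 ≤ 4 * p ^ 2 * e ^ 2 := Nat.mul_le_mul_left _ h1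
    nlinarith
  have hcop' : Nat.Coprime e (p ^ 2) :=
    (Nat.coprime_of_lt_prime hepos.ne' hlt hp).symm.pow_right 2
  have he2 : e ∣ 2 := hcop'.dvd_of_dvd_mul_right he
  rcases (Nat.dvd_prime Nat.prime_two).1 he2 with rfl | rfl
  · left; ring
  · right; ring
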